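/- arXiv:1802.10174 — 4 statements merged into one kernel-verified Lean document; each statement's English description precedes it below -/
import Mathlib

section
/- Let h : ℝ^d → ℝ be differentiable and ρ-strongly convex for some ρ > 0, and suppose its gradient map ∇h is a bijection of ℝ^d with measurable inverse ∇h⋆. Let μ₁, μ₂ be probability measures on ℝ^d, set ν₁ = (∇h)#μ₁ and ν₂ = (∇h)#μ₂, and let π be a probability measure on ℝ^d × ℝ^d whose first marginal is ν₁ and second marginal is ν₂. Then the pushforward of π under the map (y, y') ↦ (∇h⋆(y), ∇h⋆(y')) is a probability measure whose first marginal is μ₁ and second marginal is μ₂, and ∫ ‖∇h⋆(y) − ∇h⋆(y')‖² dπ(y, y') ≤ (1/ρ²) ∫ ‖y − y'‖² dπ(y, y'). -/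
open MeasureTheory
open scoped RealInnerProductSpace ENNReal

/-- A `ρ`-strongly convex function has a `ρ`-expanding gradient. -/
theorem mul_norm_sub_le_of_strong_convexity {E : Type*} [NormedAddCommGroup E]
    [InnerProductSpace ℝ E] {ρ : ℝ} {h : E → ℝ} {G : E → E}
    (hsc : ∀ x x' : E, h x' + ⟪G x', x - x'⟫ + (ρ / 2) * ‖x - x'‖ ^ 2 ≤ h x) (x x' : E) :
    ρ * ‖x - x'‖ ≤ ‖G x - G x'‖ := by
  have hmono : ρ * ‖x - x'‖ ^ 2 ≤ ⟪G x - G x', x - x'⟫ := by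
    have h₁ := hsc x x'
    have h₂ := hsc x' x
    rw [norm_sub_rev x' x, ← neg_sub x x', inner_neg_right] at h₂
    rw [inner_sub_left]
    linarith
  have hcs := real_inner_le_norm (G x - G x') (x - x')
  rcases (norm_nonneg (x - x')).eq_or_lt with h₀ | hpos
  · rw [← h₀, mul_zero]
    exact norm_nonneg _
  · refine le_of_mul_le_mul_right ?_ hpos
    linarith [sq ‖x - x'‖, mul_assoc ρ ‖x - x'‖ ‖x - x'‖, congrArg (ρ * ·) (sq ‖x - x'‖)]

/-- A measurable left inverse of `f` undoes the pushforward by `f`. -/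
theorem MeasureTheory.Measure.map_map_of_leftInverse {α β : Type*} [MeasurableSpace α]
    [MeasurableSpace β] {f : α → β} {g : β → α} (hg : Measurable g) (hf : Measurable f)
    (hgf : Function.LeftInverse g f) (μ : Measure α) : (μ.map f).map g = μ := by
  rw [Measure.map_map hg hf, hgf.comp_eq_id, Measure.map_id]

/-- Pushing a coupling of the dual measures `ν₁ = ∇h # μ₁`, `ν₂ = ∇h # μ₂`
forward through `(y, y') ↦ (∇h⋆ y, ∇h⋆ y')` gives a coupling of `μ₁, μ₂`, whose quadratic
transport cost is controlled by `1/ρ²` times that of the original coupling. -/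
theorem coupling_pushforward_wasserstein {d : ℕ} (ρ : ℝ) (hρ : 0 < ρ)
    (h : EuclideanSpace ℝ (Fin d) → ℝ)
    (hdiff : Differentiable ℝ h)
    (hsc : ∀ x x' : EuclideanSpace ℝ (Fin d),
      h x' + ⟪gradient h x', x - x'⟫ + (ρ / 2) * ‖x - x'‖ ^ 2 ≤ h x)
    (hbij : Function.Bijective (gradient h))
    (g : EuclideanSpace ℝ (Fin d) → EuclideanSpace ℝ (Fin d))
    (hg : Measurable g)
    (hgf : Function.LeftInverse g (gradient h))
    (hfg : Function.RightInverse g (gradient h))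
    (hmeas : Measurable (gradient h))
    (μ₁ μ₂ : Measure (EuclideanSpace ℝ (Fin d)))
    [IsProbabilityMeasure μ₁] [IsProbabilityMeasure μ₂]
    (π : Measure (EuclideanSpace ℝ (Fin d) × EuclideanSpace ℝ (Fin d)))
    [IsProbabilityMeasure π]
    (hπ₁ : π.map Prod.fst = μ₁.map (gradient h))
    (hπ₂ : π.map Prod.snd = μ₂.map (gradient h)) :
    IsProbabilityMeasure (π.map (fun p => (g p.1, g p.2))) ∧
    (π.map (fun p => (g p.1, g p.2))).map Prod.fst = μ₁ ∧
    (π.map (fun p => (g p.1, g p.2))).map Prod.snd = μ₂ ∧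
    (∫⁻ p, ENNReal.ofReal (‖g p.1 - g p.2‖ ^ 2) ∂π)
      ≤ ENNReal.ofReal (1 / ρ ^ 2) * ∫⁻ p, ENNReal.ofReal (‖p.1 - p.2‖ ^ 2) ∂π := by
  have hG : Measurable fun p : EuclideanSpace ℝ (Fin d) × EuclideanSpace ℝ (Fin d) =>
      (g p.1, g p.2) := by fun_prop
  refine ⟨Measure.isProbabilityMeasure_map hG.aemeasurable, ?_, ?_, ?_⟩
  · calc (π.map fun p => (g p.1, g p.2)).map Prod.fst
        = (π.map Prod.fst).map g := by
          rw [Measure.map_map measurable_fst hG, Measure.map_map hg measurable_fst]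
          rfl
      _ = μ₁ := by rw [hπ₁, Measure.map_map_of_leftInverse hg hmeas hgf]
  · calc (π.map fun p => (g p.1, g p.2)).map Prod.snd
        = (π.map Prod.snd).map g := by
          rw [Measure.map_map measurable_snd hG, Measure.map_map hg measurable_snd]
          rfl
      _ = μ₂ := by rw [hπ₂, Measure.map_map_of_leftInverse hg hmeas hgf]
  · rw [← lintegral_const_mul' _ _ ENNReal.ofReal_ne_top]
    refine lintegral_mono fun p => ?_
    rw [← ENNReal.ofReal_mul (by positivity)]
    refine ENNReal.ofReal_le_ofReal ?_
    have hexp := mul_norm_sub_le_of_strong_convexity hsc (g p.1) (g p.2)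
    rw [hfg p.1, hfg p.2] at hexp
    rw [one_div_mul_eq_div, le_div_iff₀' (by positivity), ← mul_pow]
    gcongr
end

section
/- The function f : ℝ^d → ℝ defined by f(y) = log(1 + Σ_{i=1}^d e^{y_i}) is strictly convex, differentiable with ∂f/∂y_i (y) = e^{y_i}/(1 + Σ_{j=1}^d e^{y_j}), and its gradient ∇f is 1-Lipschitz with respect to the Euclidean norm: ‖∇f(y) − ∇f(y')‖ ≤ ‖y − y'‖ for all y, y' ∈ ℝ^d. -/
open Real

/-- The softmax potential `f(y) = log(1 + ∑ᵢ e^{yᵢ})`, which is the Fenchel dual of the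
entropic mirror map on the probability simplex. -/
noncomputable def softmaxPotential {d : ℕ} (y : EuclideanSpace ℝ (Fin d)) : ℝ :=
  Real.log (1 + ∑ i, Real.exp (y i))

/-- Its gradient: `(∇f(y))ᵢ = e^{yᵢ} / (1 + ∑ⱼ e^{yⱼ})`. -/
noncomputable def softmaxGrad {d : ℕ} (y : EuclideanSpace ℝ (Fin d)) :
    EuclideanSpace ℝ (Fin d) :=
  (WithLp.equiv 2 (Fin d → ℝ)).symm
    (fun i => Real.exp (y i) / (1 + ∑ j, Real.exp (y j)))

/-- The partition function `1 + ∑ᵢ e^{yᵢ}` is positive. -/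
theorem one_add_sum_exp_pos {ι : Type*} [Fintype ι] (y : ι → ℝ) :
    0 < 1 + ∑ i, Real.exp (y i) := by
  positivity

/-- `y ↦ log (1 + ∑ᵢ e^{yᵢ})` is strictly convex. -/
theorem strictConvexOn_softmaxPotential {d : ℕ} :
    StrictConvexOn ℝ Set.univ (softmaxPotential (d := d)) := by
  refine ⟨convex_univ, fun x _ y _ hxy a b ha hb hab => ?_⟩
  have hA := one_add_sum_exp_pos x
  have hB := one_add_sum_exp_pos y
  obtain ⟨A, hAe⟩ : ∃ A, A = softmaxPotential x := ⟨_, rfl⟩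
  obtain ⟨B, hBe⟩ : ∃ B, B = softmaxPotential y := ⟨_, rfl⟩
  have hexpA : Real.exp A = 1 + ∑ i, Real.exp (x i) := by
    rw [hAe, softmaxPotential, Real.exp_log hA]
  have hexpB : Real.exp B = 1 + ∑ i, Real.exp (y i) := by
    rw [hBe, softmaxPotential, Real.exp_log hB]
  rw [← hAe, ← hBe, softmaxPotential, smul_eq_mul, smul_eq_mul,
    Real.log_lt_iff_lt_exp (one_add_sum_exp_pos _)]
  have hle (s t : ℝ) : Real.exp (a * s + b * t) ≤ a * Real.exp s + b * Real.exp t := by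
    simpa using convexOn_exp.2 (Set.mem_univ s) (Set.mem_univ t) ha.le hb.le hab
  have hlt {s t : ℝ} (h : s ≠ t) :
      Real.exp (a * s + b * t) < a * Real.exp s + b * Real.exp t := by
    simpa using strictConvexOn_exp.2 (Set.mem_univ s) (Set.mem_univ t) h ha hb hab
  have hsum : a * Real.exp (-A) + b * Real.exp (-B) +
      ∑ i, (a * Real.exp (x i - A) + b * Real.exp (y i - B)) = 1 := by
    have h₁ : Real.exp (-A) * (1 + ∑ i, Real.exp (x i)) = 1 := by
      rw [← hexpA, ← Real.exp_add]; simp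
    have h₂ : Real.exp (-B) * (1 + ∑ i, Real.exp (y i)) = 1 := by
      rw [← hexpB, ← Real.exp_add]; simp
    simp only [sub_eq_add_neg, Real.exp_add, Finset.sum_add_distrib, ← Finset.mul_sum,
      ← Finset.sum_mul]
    linear_combination a * h₁ + b * h₂ + hab
  have key : Real.exp (a * -A + b * -B) +
      ∑ i, Real.exp (a * (x i - A) + b * (y i - B)) < 1 := by
    rw [← hsum]
    by_cases hAB : A = B
    · obtain ⟨i, hi⟩ : ∃ i, x i ≠ y i := by
        by_contra! h
        exact hxy (PiLp.ext h)
      refine add_lt_add_of_le_of_lt (hle _ _)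
        (Finset.sum_lt_sum (fun j _ => hle _ _) ⟨i, Finset.mem_univ i, hlt ?_⟩)
      rw [hAB]
      exact fun h => hi (sub_left_injective h)
    · exact add_lt_add_of_lt_of_le (hlt fun h => hAB (neg_injective h))
        (Finset.sum_le_sum fun j _ => hle _ _)
  have hfac : Real.exp (a * -A + b * -B) +
      ∑ i, Real.exp (a * (x i - A) + b * (y i - B)) =
      Real.exp (-(a * A + b * B)) * (1 + ∑ i, Real.exp ((a • x + b • y) i)) := by
    rw [mul_add, Finset.mul_sum, mul_one]
    congr 1
    · ring_nf
    · refine Finset.sum_congr rfl fun i _ => ?_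
      rw [← Real.exp_add]
      simp only [PiLp.add_apply, PiLp.smul_apply, smul_eq_mul]
      ring_nf
  rw [hfac, Real.exp_neg, inv_mul_lt_iff₀ (Real.exp_pos _), mul_one] at key
  exact key

/-- The gradient of `y ↦ log (1 + ∑ᵢ e^{yᵢ})` is the softmax map. -/
theorem hasGradientAt_softmaxPotential {d : ℕ} (y : EuclideanSpace ℝ (Fin d)) :
    HasGradientAt softmaxPotential (softmaxGrad y) y := by
  rw [hasGradientAt_iff_hasFDerivAt]
  have hcoord (i : Fin d) : HasFDerivAt (fun z : EuclideanSpace ℝ (Fin d) => z i)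
      (EuclideanSpace.proj (𝕜 := ℝ) i : EuclideanSpace ℝ (Fin d) →L[ℝ] ℝ) y :=
    (EuclideanSpace.proj (𝕜 := ℝ) i).hasFDerivAt
  have h := ((HasFDerivAt.fun_sum fun i (_ : i ∈ Finset.univ) => (hcoord i).exp).const_add 1).log
    (one_add_sum_exp_pos y).ne'
  refine h.congr_fderiv ?_
  ext v
  simp [softmaxGrad, PiLp.inner_apply, Finset.mul_sum, div_eq_inv_mul]
  exact Finset.sum_congr rfl fun i _ => by ring

/-- For sub-probability weights `p`, the covariance operator `v ↦ (pᵢ (vᵢ - ∑ⱼ pⱼ vⱼ))ᵢ` is a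
contraction in the Euclidean norm. -/
theorem sum_sq_mul_sub_weighted_mean_le {ι : Type*} [Fintype ι] {p : ι → ℝ}
    (hp : ∀ i, 0 ≤ p i) (hsum : ∑ i, p i ≤ 1) (v : ι → ℝ) :
    ∑ i, (p i * (v i - ∑ j, p j * v j)) ^ 2 ≤ ∑ i, v i ^ 2 := by
  have hp1 (i : ι) : p i ≤ 1 :=
    (Finset.single_le_sum (fun j _ => hp j) (Finset.mem_univ i)).trans hsum
  obtain ⟨m, hm⟩ : ∃ m, m = ∑ j, p j * v j := ⟨_, rfl⟩
  rw [← hm]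
  calc ∑ i, (p i * (v i - m)) ^ 2
      ≤ ∑ i, p i * (v i - m) ^ 2 := by
        refine Finset.sum_le_sum fun i _ => ?_
        rw [mul_pow]
        exact mul_le_mul_of_nonneg_right (pow_le_of_le_one (hp i) (hp1 i) two_ne_zero)
          (sq_nonneg _)
    _ = ∑ i, p i * v i ^ 2 - 2 * m * ∑ i, p i * v i + m ^ 2 * ∑ i, p i := by
        rw [Finset.mul_sum, Finset.mul_sum, ← Finset.sum_sub_distrib, ← Finset.sum_add_distrib]
        exact Finset.sum_congr rfl fun i _ => by ring
    _ ≤ ∑ i, p i * v i ^ 2 := by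
        rw [← hm]
        nlinarith [mul_le_mul_of_nonneg_left hsum (sq_nonneg m), sq_nonneg m]
    _ ≤ ∑ i, v i ^ 2 :=
        Finset.sum_le_sum fun i _ => mul_le_of_le_one_left (sq_nonneg _) (hp1 i)

/-- The derivative of the softmax map along a line. -/
theorem hasDerivAt_softmaxGrad_line {d : ℕ} (y v : EuclideanSpace ℝ (Fin d)) (t : ℝ) :
    HasDerivAt (fun s : ℝ => softmaxGrad (y + s • v))
      (WithLp.toLp 2 fun i => softmaxGrad (y + t • v) i *
        (v i - ∑ j, softmaxGrad (y + t • v) j * v j)) t := by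
  rw [hasDerivAt_iff_hasFDerivAt, ← hasFDerivWithinAt_univ, hasFDerivWithinAt_euclidean]
  intro i
  rw [hasFDerivWithinAt_univ]
  have hexp (j : Fin d) : HasDerivAt (fun s : ℝ => Real.exp ((y + s • v) j))
      (Real.exp ((y + t • v) j) * v j) t := by
    have := (((hasDerivAt_id t).mul_const (v j)).const_add (y j)).exp
    simpa using this
  have hZ := one_add_sum_exp_pos (y + t • v)
  have h := (hexp i).fun_div
    ((HasDerivAt.fun_sum fun j (_ : j ∈ Finset.univ) => hexp j).const_add 1) hZ.ne'
  refine h.hasFDerivAt.congr_fderiv ?_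
  ext
  have hmean : ∑ j, softmaxGrad (y + t • v) j * v j =
      (∑ j, Real.exp ((y + t • v) j) * v j) / (1 + ∑ j, Real.exp ((y + t • v) j)) := by
    simp [softmaxGrad, div_mul_eq_mul_div, Finset.sum_div]
  simp only [hmean]
  simp [softmaxGrad] at hZ ⊢
  field_simp

/-- The softmax map is `1`-Lipschitz in the Euclidean norm. -/
theorem norm_softmaxGrad_sub_le {d : ℕ} (y y' : EuclideanSpace ℝ (Fin d)) :
    ‖softmaxGrad y - softmaxGrad y'‖ ≤ ‖y - y'‖ := by
  have h := norm_image_sub_le_of_norm_deriv_le_segment_01' (C := ‖y - y'‖)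
    (fun t _ => (hasDerivAt_softmaxGrad_line y' (y - y') t).hasDerivWithinAt) fun t _ => ?_
  · simpa using h
  · have hZ := one_add_sum_exp_pos (y' + t • (y - y'))
    rw [EuclideanSpace.norm_eq, EuclideanSpace.norm_eq]
    refine Real.sqrt_le_sqrt ?_
    simp only [Real.norm_eq_abs, sq_abs]
    refine sum_sq_mul_sub_weighted_mean_le (fun i => ?_) ?_ _
    · exact div_nonneg (Real.exp_pos _).le hZ.le
    · change ∑ i, Real.exp _ / _ ≤ 1
      rw [← Finset.sum_div, div_le_one hZ]
      linarith

/-- `f(y) = log(1 + ∑ᵢ e^{yᵢ})` is strictly convex, differentiable with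
`∂f/∂yᵢ = e^{yᵢ}/(1 + ∑ⱼ e^{yⱼ})`, and its gradient is 1-Lipschitz in the Euclidean norm. -/
theorem softmaxPotential_properties {d : ℕ} :
    StrictConvexOn ℝ Set.univ (softmaxPotential (d := d)) ∧
    (∀ y : EuclideanSpace ℝ (Fin d), HasGradientAt softmaxPotential (softmaxGrad y) y) ∧
    (∀ y y' : EuclideanSpace ℝ (Fin d), ‖softmaxGrad y - softmaxGrad y'‖ ≤ ‖y - y'‖) := by
  exact ⟨strictConvexOn_softmaxPotential, hasGradientAt_softmaxPotential,
    norm_softmaxGrad_sub_le⟩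
end

section
/- Let a_1, …, a_{d+1} be strictly positive reals and set A = Σ_{ℓ=1}^{d+1} a_ℓ. Then the function W : ℝ^d → ℝ defined by W(y) = −Σ_{ℓ=1}^d a_ℓ y_ℓ + A·log(1 + Σ_{ℓ=1}^d e^{y_ℓ}) is strictly convex on ℝ^d, and its gradient ∇W is A-Lipschitz with respect to the Euclidean norm: ‖∇W(y) − ∇W(y')‖ ≤ A·‖y − y'‖ for all y, y'. -/
/-- The softmax map with one reference category, as a map into Euclidean space. -/
noncomputable def anchoredSoftmax {d : ℕ} (y : EuclideanSpace ℝ (Fin d)) :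
    EuclideanSpace ℝ (Fin d) :=
  WithLp.toLp 2 fun i => Real.exp (y i) / (1 + ∑ j, Real.exp (y j))

lemma one_add_sum_exp_pos_s13 {d : ℕ} (y : Fin d → ℝ) : 0 < 1 + ∑ j, Real.exp (y j) := by
  positivity

/-- The function `y ↦ log (1 + ∑ exp yᵢ)` is strictly convex. -/
lemma strictConvexOn_log_one_add_sum_exp (d : ℕ) :
    StrictConvexOn ℝ Set.univ
      (fun y : EuclideanSpace ℝ (Fin d) => Real.log (1 + ∑ j, Real.exp (y j))) := by
  refine ⟨convex_univ, fun x _ y _ hxy s t hs ht hst => ?_⟩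
  have hX := one_add_sum_exp_pos_s13 x
  have hY := one_add_sum_exp_pos_s13 y
  set X := 1 + ∑ j, Real.exp (x j) with hXdef
  set Y := 1 + ∑ j, Real.exp (y j) with hYdef
  simp only [smul_eq_mul, PiLp.add_apply, PiLp.smul_apply]
  rw [Real.log_lt_iff_lt_exp (by positivity)]
  set c := s * Real.log X + t * Real.log Y with hc
  have key : ∀ u v : ℝ, Real.exp (s * (u - Real.log X) + t * (v - Real.log Y)) ≤
      s * (Real.exp u / X) + t * (Real.exp v / Y) := fun u v => by
    have := convexOn_exp.2 (Set.mem_univ (u - Real.log X)) (Set.mem_univ (v - Real.log Y))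
      hs.le ht.le hst
    simpa [Real.exp_sub, Real.exp_log hX, Real.exp_log hY] using this
  have key' : ∀ u v : ℝ, u - Real.log X ≠ v - Real.log Y →
      Real.exp (s * (u - Real.log X) + t * (v - Real.log Y)) <
      s * (Real.exp u / X) + t * (Real.exp v / Y) := fun u v h => by
    have := strictConvexOn_exp.2 (Set.mem_univ (u - Real.log X))
      (Set.mem_univ (v - Real.log Y)) h hs ht hst
    simpa [Real.exp_sub, Real.exp_log hX, Real.exp_log hY] using this
  have hshift : ∀ u v : ℝ, Real.exp (s * (u - Real.log X) + t * (v - Real.log Y)) =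
      Real.exp (s * u + t * v) / Real.exp c := fun u v => by
    rw [← Real.exp_sub, hc]; ring_nf
  have htotal : (s * (Real.exp 0 / X) + t * (Real.exp 0 / Y)) +
      ∑ j, (s * (Real.exp (x j) / X) + t * (Real.exp (y j) / Y)) = 1 := by
    rw [Finset.sum_add_distrib, ← Finset.mul_sum, ← Finset.mul_sum, ← Finset.sum_div,
      ← Finset.sum_div, Real.exp_zero]
    calc _ = s * ((1 + ∑ j, Real.exp (x j)) / X) + t * ((1 + ∑ j, Real.exp (y j)) / Y) := by ring
      _ = 1 := by rw [← hXdef, ← hYdef, div_self hX.ne', div_self hY.ne']; linarith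
  have hlt : Real.exp (s * (0 - Real.log X) + t * (0 - Real.log Y)) +
      ∑ j, Real.exp (s * (x j - Real.log X) + t * (y j - Real.log Y)) < 1 := by
    rw [← htotal]
    by_cases h : (0 : ℝ) - Real.log X = 0 - Real.log Y
    · refine add_lt_add_of_le_of_lt (key 0 0) ?_
      obtain ⟨i, hi⟩ : ∃ i, x i ≠ y i := by
        by_contra! hcon
        exact hxy (by ext i; exact hcon i)
      exact Finset.sum_lt_sum (fun j _ => key _ _)
        ⟨i, Finset.mem_univ i, key' _ _ fun h' => hi (by linarith)⟩
    · exact add_lt_add_of_lt_of_le (key' 0 0 h) (Finset.sum_le_sum fun j _ => key _ _)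
  simp only [hshift, ← Finset.sum_div, ← add_div] at hlt
  rw [div_lt_one (Real.exp_pos c)] at hlt
  simpa using hlt

lemma hasGradientAt_log_one_add_sum_exp {d : ℕ} (y : EuclideanSpace ℝ (Fin d)) :
    HasGradientAt (fun y : EuclideanSpace ℝ (Fin d) => Real.log (1 + ∑ j, Real.exp (y j)))
      (anchoredSoftmax y) y := by
  have hcoord : ∀ j, HasFDerivAt (fun y : EuclideanSpace ℝ (Fin d) => y j)
      (EuclideanSpace.proj j : EuclideanSpace ℝ (Fin d) →L[ℝ] ℝ) y := fun j =>
    (EuclideanSpace.proj j : EuclideanSpace ℝ (Fin d) →L[ℝ] ℝ).hasFDerivAt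
  have h := ((HasFDerivAt.fun_sum (u := Finset.univ) fun j _ => (hcoord j).exp).const_add 1).log
    (one_add_sum_exp_pos_s13 y).ne'
  rw [hasGradientAt_iff_hasFDerivAt]
  refine h.congr_fderiv ?_
  ext v
  simp [anchoredSoftmax, PiLp.inner_apply, Finset.mul_sum]
  refine Finset.sum_congr rfl fun j _ => ?_
  ring

/-- The Jacobian of a softmax is a contraction. -/
lemma sum_sq_mul_sub_mean_le {ι : Type*} [Fintype ι] (p v : ι → ℝ) (hp : ∀ i, 0 ≤ p i)
    (hsum : ∑ i, p i ≤ 1) :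
    ∑ i, (p i * (v i - ∑ j, p j * v j)) ^ 2 ≤ ∑ i, v i ^ 2 := by
  set m := ∑ j, p j * v j with hm
  have hp1 : ∀ i, p i ≤ 1 := fun i =>
    (Finset.single_le_sum (fun j _ => hp j) (Finset.mem_univ i)).trans hsum
  calc ∑ i, (p i * (v i - m)) ^ 2 ≤ ∑ i, p i * (v i - m) ^ 2 := by
        refine Finset.sum_le_sum fun i _ => ?_
        rw [mul_pow]
        exact mul_le_mul_of_nonneg_right (by nlinarith [hp i, hp1 i]) (sq_nonneg _)
    _ = ∑ i, p i * v i ^ 2 - 2 * m * ∑ i, p i * v i + m ^ 2 * ∑ i, p i := by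
        rw [Finset.mul_sum _ _ (2 * m), Finset.mul_sum _ _ (m ^ 2), ← Finset.sum_sub_distrib,
          ← Finset.sum_add_distrib]
        exact Finset.sum_congr rfl fun i _ => by ring
    _ ≤ ∑ i, p i * v i ^ 2 := by
        rw [← hm]
        nlinarith [mul_le_mul_of_nonneg_left hsum (sq_nonneg m), sq_nonneg m]
    _ ≤ ∑ i, v i ^ 2 := Finset.sum_le_sum fun i _ =>
        mul_le_of_le_one_left (sq_nonneg _) (hp1 i)

lemma norm_anchoredSoftmax_sub_le {d : ℕ} (y y' : EuclideanSpace ℝ (Fin d)) :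
    ‖anchoredSoftmax y - anchoredSoftmax y'‖ ≤ ‖y - y'‖ := by
  set v := y - y' with hv
  let z : ℝ → EuclideanSpace ℝ (Fin d) := fun t => y' + t • v
  let D : ℝ → EuclideanSpace ℝ (Fin d) := fun t => WithLp.toLp 2 fun i =>
    anchoredSoftmax (z t) i * (v i - ∑ j, anchoredSoftmax (z t) j * v j)
  have hderiv : ∀ t, HasDerivAt (fun t => anchoredSoftmax (z t)) (D t) t := fun t => by
    have hcoord : ∀ i, HasDerivAt (fun t => Real.exp (z t i))
        (Real.exp (z t i) * v i) t := fun i => by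
      have := ((hasDerivAt_id t).mul_const (v i)).const_add (y' i)
      simpa [z] using this.exp
    have hS := (HasDerivAt.fun_sum (u := Finset.univ) fun i _ => hcoord i).const_add 1
    have hpos := one_add_sum_exp_pos_s13 (z t)
    rw [hasDerivAt_iff_hasFDerivAt, ← hasFDerivWithinAt_univ, hasFDerivWithinAt_euclidean]
    intro i
    rw [hasFDerivWithinAt_univ]
    refine ((hcoord i).div hS hpos.ne').hasFDerivAt.congr_fderiv ?_
    ext
    simp only [D, anchoredSoftmax, div_mul_eq_mul_div, ← Finset.sum_div]
    simp
    field_simp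
  have hbound : ∀ t, ‖D t‖ ≤ ‖v‖ := fun t => by
    have hpos := one_add_sum_exp_pos_s13 (z t)
    rw [EuclideanSpace.norm_eq, EuclideanSpace.norm_eq]
    refine Real.sqrt_le_sqrt ?_
    simp only [Real.norm_eq_abs, sq_abs]
    refine sum_sq_mul_sub_mean_le (fun i => anchoredSoftmax (z t) i) v (fun i => ?_) ?_
    · exact div_nonneg (Real.exp_pos _).le hpos.le
    · simp only [anchoredSoftmax, ← Finset.sum_div]
      rw [div_le_one hpos]
      linarith
  have := norm_image_sub_le_of_norm_deriv_le_segment_01'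
    (fun t _ => (hderiv t).hasDerivWithinAt) (fun t _ => hbound t)
  simpa [z, hv] using this

/-- For positive `a₁, …, a_{d+1}` with `A = ∑ aₗ`, the dual Dirichlet
potential `W(y) = −∑_{ℓ=1}^d aₗ yₗ + A·log(1 + ∑ e^{yₗ})` is strictly convex on `ℝ^d`
and its gradient is `A`-Lipschitz in the Euclidean norm. -/
theorem dual_dirichlet_potential_convex_lipschitz {d : ℕ}
    (a : Fin (d + 1) → ℝ) (ha : ∀ ℓ, 0 < a ℓ) (A : ℝ) (hA : A = ∑ ℓ, a ℓ)
    (W : EuclideanSpace ℝ (Fin d) → ℝ)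
    (hW : ∀ y, W y = -∑ ℓ : Fin d, a ℓ.castSucc * y ℓ
        + A * Real.log (1 + ∑ ℓ, Real.exp (y ℓ))) :
    StrictConvexOn ℝ Set.univ W ∧
    ∀ y y' : EuclideanSpace ℝ (Fin d),
      ‖gradient W y - gradient W y'‖ ≤ A * ‖y - y'‖ := by
  have hApos : 0 < A := hA ▸ Finset.sum_pos (fun ℓ _ => ha ℓ) Finset.univ_nonempty
  let b : EuclideanSpace ℝ (Fin d) := WithLp.toLp 2 fun ℓ => -a ℓ.castSucc
  have hWb : W = fun y => innerSL ℝ b y + A * Real.log (1 + ∑ ℓ, Real.exp (y ℓ)) := by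
    funext y
    simp [hW, b, PiLp.inner_apply, mul_comm]
  constructor
  · rw [hWb]
    refine ⟨convex_univ, fun x hx y hy hxy s t hs ht hst => ?_⟩
    have h := mul_lt_mul_of_pos_left
      ((strictConvexOn_log_one_add_sum_exp d).2 hx hy hxy hs ht hst) hApos
    simp only [map_add, map_smul, smul_eq_mul] at h ⊢
    linarith
  · have hgrad : ∀ y, gradient W y = b + A • anchoredSoftmax y := fun y => by
      refine HasGradientAt.gradient ?_
      rw [hWb, hasGradientAt_iff_hasFDerivAt]
      refine ((innerSL ℝ b).hasFDerivAt.add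
        ((hasGradientAt_log_one_add_sum_exp y).hasFDerivAt.const_mul A)).congr_fderiv ?_
      ext v
      simp
    intro y y'
    rw [hgrad, hgrad, add_sub_add_left_eq_sub, ← smul_sub, norm_smul, Real.norm_of_nonneg hApos.le]
    exact mul_le_mul_of_nonneg_left (norm_anchoredSoftmax_sub_le y y') hApos.le
end

section
/- Let U ⊆ ℝ^d be open and convex, let h : U → ℝ be twice differentiable with ∇²h(x) ⪰ I (the identity matrix) for all x ∈ U, and suppose ∇h : U → ℝ^d is a bijection with differentiable inverse ∇h⋆ : ℝ^d → U. Let N ≥ 1, let V_1, …, V_N : U → ℝ and φ : U → ℝ be differentiable, let W_1, …, W_N : ℝ^d → ℝ be differentiable, and let c_1, …, c_N ∈ ℝ be such that W_i(∇h(x)) = V_i(x) + (1/N)·φ(x) + c_i for all x ∈ U and all i. Set V = Σ_{i=1}^N V_i and W = Σ_{i=1}^N W_i. Then for every y ∈ ℝ^d, (1/N)·Σ_{i=1}^N ‖N·∇W_i(y) − ∇W(y)‖² ≤ (1/N)·Σ_{i=1}^N ‖N·∇V_i(∇h⋆(y)) − ∇V(∇h⋆(y))‖². -/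
open Real Finset
open scoped RealInnerProductSpace

section Gradient

variable {E : Type*} [NormedAddCommGroup E] [InnerProductSpace ℝ E]

/-- A continuous linear right inverse of a map `A` with `‖v‖² ≤ ⟪A v, v⟫` is a contraction. -/
lemma ContinuousLinearMap.opNorm_le_one_of_comp_eq_id {A D : E →L[ℝ] E}
    (hA : ∀ v, ‖v‖ ^ 2 ≤ ⟪A v, v⟫) (hAD : A.comp D = ContinuousLinearMap.id ℝ E) :
    ‖D‖ ≤ 1 := by
  refine D.opNorm_le_bound zero_le_one fun v => ?_
  have hv : A (D v) = v := congrArg (fun L : E →L[ℝ] E => L v) hAD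
  have h₁ := hA (D v)
  rw [hv] at h₁
  have h₂ := real_inner_le_norm v (D v)
  rcases (norm_nonneg (D v)).eq_or_lt with h₀ | h₀
  · rw [← h₀, one_mul]
    exact norm_nonneg v
  · nlinarith

variable [CompleteSpace E]

/-- The norm of a gradient is the norm of the Fréchet derivative. -/
lemma norm_gradient_eq_norm_fderiv (f : E → ℝ) (x : E) : ‖gradient f x‖ = ‖fderiv ℝ f x‖ :=
  (InnerProductSpace.toDual ℝ E).symm.norm_map _

/-- The deviation `a ∇fᵢ - ∇(∑ⱼ fⱼ)` is the gradient of `a fᵢ - ∑ⱼ fⱼ`. -/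
lemma smul_gradient_sub_gradient_sum {ι : Type*} [Fintype ι] {f : ι → E → ℝ} {x : E}
    (hf : ∀ i, DifferentiableAt ℝ (f i) x) (a : ℝ) (i : ι) :
    a • gradient (f i) x - gradient (fun z => ∑ j, f j z) x
      = gradient (fun z => a * f i z - ∑ j, f j z) x := by
  have hsum : DifferentiableAt ℝ (fun z => ∑ j, f j z) x :=
    DifferentiableAt.fun_sum fun j _ => hf j
  simp only [gradient]
  rw [fderiv_fun_sub ((hf i).const_mul a) hsum, fderiv_const_mul (hf i), map_sub]
  simp

end Gradient

/-- Let `h` be twice differentiable on an open convex `U` with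
`∇²h ⪰ I`, with gradient map a bijection from `U` onto `ℝ^d` whose inverse `∇h⋆` is
differentiable. If `Wᵢ(∇h(x)) = Vᵢ(x) + (1/N)·φ(x) + cᵢ` on `U` for all `i`, then for
every `y` the dual stochastic-gradient variance is dominated by the primal one:
`(1/N)·∑ᵢ ‖N∇Wᵢ(y) − ∇W(y)‖² ≤ (1/N)·∑ᵢ ‖N∇Vᵢ(∇h⋆(y)) − ∇V(∇h⋆(y))‖²`. -/
theorem dual_stochastic_gradient_variance_contraction {d N : ℕ} (hN : 1 ≤ N)
    (U : Set (EuclideanSpace ℝ (Fin d))) (hUopen : IsOpen U) (hUconv : Convex ℝ U)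
    (h : EuclideanSpace ℝ (Fin d) → ℝ)
    (hdiff : ∀ x ∈ U, DifferentiableAt ℝ h x)
    (hdiff2 : ∀ x ∈ U, DifferentiableAt ℝ (gradient h) x)
    (hhess : ∀ x ∈ U, ∀ v : EuclideanSpace ℝ (Fin d),
      ‖v‖ ^ 2 ≤ ⟪fderiv ℝ (gradient h) x v, v⟫)
    (hinjU : Set.InjOn (gradient h) U)
    (hs : EuclideanSpace ℝ (Fin d) → EuclideanSpace ℝ (Fin d))
    (hsU : ∀ y, hs y ∈ U)
    (hs_left : ∀ x ∈ U, hs (gradient h x) = x)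
    (hs_right : ∀ y, gradient h (hs y) = y)
    (hs_diff : Differentiable ℝ hs)
    (V : Fin N → EuclideanSpace ℝ (Fin d) → ℝ)
    (hVdiff : ∀ i, ∀ x ∈ U, DifferentiableAt ℝ (V i) x)
    (φ : EuclideanSpace ℝ (Fin d) → ℝ)
    (hφdiff : ∀ x ∈ U, DifferentiableAt ℝ φ x)
    (W : Fin N → EuclideanSpace ℝ (Fin d) → ℝ)
    (hWdiff : ∀ i, Differentiable ℝ (W i))
    (c : Fin N → ℝ)
    (hrel : ∀ x ∈ U, ∀ i, W i (gradient h x) = V i x + (1 / (N : ℝ)) * φ x + c i) :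
    ∀ y : EuclideanSpace ℝ (Fin d),
      (1 / (N : ℝ)) * ∑ i, ‖(N : ℝ) • gradient (W i) y - gradient (fun z => ∑ j, W j z) y‖ ^ 2
        ≤ (1 / (N : ℝ)) * ∑ i, ‖(N : ℝ) • gradient (V i) (hs y)
            - gradient (fun z => ∑ j, V j z) (hs y)‖ ^ 2 := by
  intro y
  have hD : ‖fderiv ℝ hs y‖ ≤ 1 := by
    refine ContinuousLinearMap.opNorm_le_one_of_comp_eq_id (hhess (hs y) (hsU y)) ?_
    rw [← fderiv_comp y (hdiff2 _ (hsU y)) (hs_diff y),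
      show gradient h ∘ hs = id from funext hs_right, fderiv_id]
  have hV : ∀ i, DifferentiableAt ℝ (V i) (hs y) := fun i => hVdiff i _ (hsU y)
  refine mul_le_mul_of_nonneg_left (sum_le_sum fun i _ => ?_) (by positivity)
  rw [smul_gradient_sub_gradient_sum (fun j => hWdiff j y),
    smul_gradient_sub_gradient_sum hV, norm_gradient_eq_norm_fderiv,
    norm_gradient_eq_norm_fderiv]
  set G : EuclideanSpace ℝ (Fin d) → ℝ := fun x => (N : ℝ) * V i x - ∑ j, V j x with hG
  have hGdiff : DifferentiableAt ℝ G (hs y) :=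
    ((hV i).const_mul _).sub (DifferentiableAt.fun_sum fun j _ => hV j)
  have hF : (fun z => (N : ℝ) * W i z - ∑ j, W j z)
      = fun z => (G ∘ hs) z + ((N : ℝ) * c i - ∑ j, c j) := by
    funext z
    have hW : ∀ j, W j z = V j (hs z) + (1 / (N : ℝ)) * φ (hs z) + c j := fun j => by
      simpa only [hs_right] using hrel (hs z) (hsU z) j
    simp only [hW, hG, Function.comp_apply, sum_add_distrib, sum_const, card_univ,
      Fintype.card_fin, nsmul_eq_mul]
    ring
  rw [hF, fderiv_add_const, fderiv_comp y hGdiff (hs_diff y)]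
  gcongr
  calc ‖(fderiv ℝ G (hs y)).comp (fderiv ℝ hs y)‖
      ≤ ‖fderiv ℝ G (hs y)‖ * ‖fderiv ℝ hs y‖ := ContinuousLinearMap.opNorm_comp_le _ _
    _ ≤ ‖fderiv ℝ G (hs y)‖ := mul_le_of_le_one_right (norm_nonneg _) hD
end
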